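/- arXiv:2601.03442 — 2 statements merged into one kernel-verified Lean document; each statement's English description precedes it below -/
import Mathlib

section
/- Let 0 < μ < L and let f : ℝ^d → ℝ be a differentiable function that is μ-strongly convex and L-smooth. Then for all x, y ∈ ℝ^d, f(x) − f(y) − ⟨∇f(y), x − y⟩ ≥ (1/2)·(1 − μ/L)·[ (1/L)·‖∇f(x) − ∇f(y)‖² + μ·‖x − y‖² − (2μ/L)·⟨∇f(y) − ∇f(x), y − x⟩ ]. -/
open RealInnerProductSpace

section GradientBounds

variable {E : Type*} [NormedAddCommGroup E] [InnerProductSpace ℝ E] [CompleteSpace E]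
  {f : E → ℝ} {g : E → E}

/-- A quadratic lower bound from monotonicity of the gradient with modulus `m` (of any sign). -/
theorem quadratic_le_of_hasGradientAt {m : ℝ} (hf : ∀ x, HasGradientAt f (g x) x)
    (hg : ∀ x y, m * ‖x - y‖ ^ 2 ≤ ⟪g x - g y, x - y⟫) (x y : E) :
    f y + ⟪g y, x - y⟫ + m / 2 * ‖x - y‖ ^ 2 ≤ f x := by
  set h := x - y with hh
  let φ : ℝ → ℝ := fun t => f (y + t • h) - t * ⟪g y, h⟫ - m / 2 * ‖h‖ ^ 2 * t ^ 2
  have hφ (t : ℝ) : HasDerivAt φ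
      (⟪g (y + t • h), h⟫ - ⟪g y, h⟫ - m / 2 * ‖h‖ ^ 2 * (2 * t)) t := by
    have hline : HasDerivAt (fun s : ℝ => y + s • h) h t := by
      simpa using ((hasDerivAt_id t).smul_const h).const_add y
    have hcomp := (hf (y + t • h)).hasFDerivAt.comp_hasDerivAt t hline
    have hlin := (hasDerivAt_id t).mul_const ⟪g y, h⟫
    have hsq := (hasDerivAt_pow 2 t).const_mul (m / 2 * ‖h‖ ^ 2)
    exact ((hcomp.sub hlin).sub hsq).congr_deriv (by simp)
  have hmono : MonotoneOn φ (Set.Icc 0 1) := by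
    refine monotoneOn_of_deriv_nonneg (convex_Icc 0 1)
      (fun t _ => (hφ t).continuousAt.continuousWithinAt)
      (fun t _ => (hφ t).differentiableAt.differentiableWithinAt) fun t ht => ?_
    rw [interior_Icc] at ht
    have hgt := hg (y + t • h) y
    rw [add_sub_cancel_left, norm_smul, mul_pow, Real.norm_eq_abs, sq_abs, inner_smul_right,
      inner_sub_left] at hgt
    rw [(hφ t).deriv]
    refine nonneg_of_mul_nonneg_right ?_ ht.1
    linarith
  have h01 := hmono (Set.left_mem_Icc.2 zero_le_one) (Set.right_mem_Icc.2 zero_le_one) zero_le_one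
  simp only [φ, zero_smul, one_smul, add_zero, hh, add_sub_cancel] at h01 ⊢
  linarith

/-- The descent lemma for a function with Lipschitz gradient. -/
theorem le_quadratic_of_hasGradientAt {L : ℝ} (hf : ∀ x, HasGradientAt f (g x) x)
    (hg : ∀ x y, ‖g x - g y‖ ≤ L * ‖x - y‖) (x y : E) :
    f x ≤ f y + ⟪g y, x - y⟫ + L / 2 * ‖x - y‖ ^ 2 := by
  have hneg (x : E) : HasGradientAt (fun z => -f z) (-g x) x := by
    rw [hasGradientAt_iff_hasFDerivAt, map_neg]
    exact (hf x).hasFDerivAt.neg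
  have hmon (x y : E) : -L * ‖x - y‖ ^ 2 ≤ ⟪-g x - -g y, x - y⟫ := by
    have hcs := real_inner_le_norm (g x - g y) (x - y)
    have hmul := mul_le_mul_of_nonneg_right (hg x y) (norm_nonneg (x - y))
    rw [← neg_sub', inner_neg_left]
    linarith
  have hlow := quadratic_le_of_hasGradientAt hneg hmon x y
  rw [inner_neg_left] at hlow
  linarith

/-- The sharp interpolation inequality for smooth strongly convex functions. -/
theorem strongConvex_smooth_interpolation {μ L : ℝ} (hμL : μ < L)
    (hf : ∀ x, HasGradientAt f (g x) x)
    (hsmooth : ∀ x y, ‖g x - g y‖ ≤ L * ‖x - y‖)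
    (hconv : ∀ x y, μ * ‖x - y‖ ^ 2 ≤ ⟪g x - g y, x - y⟫) (x y : E) :
    μ / 2 * ‖x - y‖ ^ 2 + ‖μ • (x - y) - (g x - g y)‖ ^ 2 / (2 * (L - μ)) ≤
      f x - f y - ⟪g y, x - y⟫ := by
  have hLμ : L - μ ≠ 0 := (sub_pos.2 hμL).ne'
  set h := x - y with hh
  set p := μ • h - (g x - g y) with hp
  set w := (L - μ)⁻¹ • p with hw
  have hlow := quadratic_le_of_hasGradientAt hf hconv (x + w) y
  have hupp := le_quadratic_of_hasGradientAt hf hsmooth (x + w) x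
  rw [add_sub_cancel_left] at hupp
  rw [add_sub_right_comm, ← hh, norm_add_sq_real, inner_add_right] at hlow
  have hpw : ⟪p, w⟫ = μ * ⟪h, w⟫ - (⟪g x, w⟫ - ⟪g y, w⟫) := by
    rw [hp, inner_sub_left, inner_sub_left, real_inner_smul_left]
  have hpw' : ⟪p, w⟫ = (L - μ)⁻¹ * ‖p‖ ^ 2 := by
    rw [hw, real_inner_smul_right, real_inner_self_eq_norm_sq]
  have hww : ‖w‖ ^ 2 = (L - μ)⁻¹ ^ 2 * ‖p‖ ^ 2 := by
    rw [hw, norm_smul, mul_pow, Real.norm_eq_abs, sq_abs]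
  have hval : ‖p‖ ^ 2 / (2 * (L - μ)) = ⟪p, w⟫ - (L - μ) / 2 * ‖w‖ ^ 2 := by
    rw [hpw', hww]
    field_simp
    ring
  linarith

end GradientBounds

/-- Necessity direction of the smooth strongly convex interpolation conditions
(Lemma 1, inequality (12)): any differentiable, `μ`-strongly convex, `L`-smooth
function satisfies the interpolation inequality at every pair of points. -/
theorem stmt_0 {d : ℕ} {μ L : ℝ} (hμ : 0 < μ) (hμL : μ < L)
    (f : EuclideanSpace ℝ (Fin d) → ℝ) (hdiff : Differentiable ℝ f)
    (hsmooth : ∀ x y, ‖gradient f x - gradient f y‖ ≤ L * ‖x - y‖)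
    (hconv : ∀ x y, ⟪gradient f x - gradient f y, x - y⟫ ≥ μ * ‖x - y‖ ^ 2) :
    ∀ x y, f x - f y - ⟪gradient f y, x - y⟫ ≥
      (1 / 2) * (1 - μ / L) *
        ((1 / L) * ‖gradient f x - gradient f y‖ ^ 2 + μ * ‖x - y‖ ^ 2
          - (2 * μ / L) * ⟪gradient f y - gradient f x, y - x⟫) := by
  intro x y
  have hL : 0 < L := hμ.trans hμL
  have hLμ : 0 < L - μ := sub_pos.2 hμL
  have hsharp := strongConvex_smooth_interpolation hμL (fun z => (hdiff z).hasGradientAt)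
    hsmooth hconv x y
  have hinner : ⟪gradient f y - gradient f x, y - x⟫ = ⟪gradient f x - gradient f y, x - y⟫ := by
    rw [← neg_sub (gradient f x), ← neg_sub x, inner_neg_neg]
  have hexpand : ‖μ • (x - y) - (gradient f x - gradient f y)‖ ^ 2 = μ ^ 2 * ‖x - y‖ ^ 2
      - 2 * μ * ⟪gradient f x - gradient f y, x - y⟫ + ‖gradient f x - gradient f y‖ ^ 2 := by
    rw [norm_sub_sq_real, norm_smul, mul_pow, Real.norm_eq_abs, sq_abs, real_inner_smul_left,
      real_inner_comm]
    ring
  rw [hinner]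
  refine ge_iff_le.2 (le_trans ?_ hsharp)
  set P := ‖μ • (x - y) - (gradient f x - gradient f y)‖ ^ 2
  set H := ‖x - y‖ ^ 2
  have hP : 0 ≤ P := sq_nonneg _
  have hH : 0 ≤ H := sq_nonneg _
  have hnonneg : 0 ≤ P + (L - μ) * μ * H := by positivity
  calc _ = (L - μ) / (2 * L ^ 2) * (P + (L - μ) * μ * H) := by
        rw [hexpand]
        field_simp
        ring
    _ ≤ 1 / (2 * (L - μ)) * (P + (L - μ) * μ * H) := by
        refine mul_le_mul_of_nonneg_right ?_ hnonneg
        rw [div_le_div_iff₀ (by positivity) (by positivity)]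
        nlinarith
    _ = μ / 2 * H + P / (2 * (L - μ)) := by
        field_simp
        ring
end

section
/- Let f_1, …, f_N : ℝ^d → ℝ be differentiable, μ-strongly convex (μ > 0) functions, let α > 0, and let W be a symmetric doubly stochastic N × N matrix whose eigenspace for eigenvalue 1 is spanned by the all-ones vector 𝟏 (i.e., Wz = z implies z is a constant multiple of 𝟏). Suppose (x_1, …, x_N, y_1, …, y_N) ∈ (ℝ^d)^N × (ℝ^d)^N is a fixed point of the DIGing communication step, i.e., x_i = ∑_j W_{ij} x_j − α y_i and y_i = ∑_j W_{ij} y_j for all i, and that the gradient-tracking invariant ∑_{i=1}^N y_i = ∑_{i=1}^N ∇f_i(x_i) holds. Then y_i = 0 for all i, all x_i are equal to a common point x̄, and x̄ = x*, the unique minimizer of f = (1/N)·∑_{i=1}^N f_i. -/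
open RealInnerProductSpace

/-- A differentiable function with strictly monotone gradient lies strictly above each of its
tangent planes, away from the point of tangency. -/
theorem add_inner_gradient_lt_of_strictMono_gradient {E : Type*} [NormedAddCommGroup E]
    [InnerProductSpace ℝ E] [CompleteSpace E] {f : E → ℝ} (hf : Differentiable ℝ f)
    (hmono : ∀ u v, u ≠ v → 0 < inner ℝ (gradient f u - gradient f v) (u - v))
    {u z : E} (hz : z ≠ u) :
    f u + inner ℝ (gradient f u) (z - u) < f z := by
  have hderiv (t : ℝ) : HasDerivAt (fun t : ℝ => f (u + t • (z - u)))
      (inner ℝ (gradient f (u + t • (z - u))) (z - u)) t := by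
    have hline : HasDerivAt (fun t : ℝ => u + t • (z - u)) (z - u) t := by
      simpa using ((hasDerivAt_id t).smul_const (z - u)).const_add u
    exact (hf _).hasGradientAt.hasFDerivAt.comp_hasDerivAt t hline
  obtain ⟨t, ⟨ht, -⟩, heq⟩ := exists_hasDerivAt_eq_slope _ _ zero_lt_one
    (fun t _ => (hderiv t).continuousAt.continuousWithinAt) (fun t _ => hderiv t)
  have hv : z - u ≠ 0 := sub_ne_zero.mpr hz
  have hpos := hmono (u + t • (z - u)) u (by simp [ht.ne', hv])
  rw [add_sub_cancel_left, inner_smul_right, inner_sub_left] at hpos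
  have hlt := pos_of_mul_pos_right hpos ht.le
  simp only [one_smul, zero_smul, add_zero, add_sub_cancel, sub_zero, div_one] at heq
  linarith

/-- If the fixed vectors of a matrix are constant, then so are its fixed families of points of
Euclidean space. -/
theorem exists_eq_const_of_sum_smul_eq {ι κ : Type*} [Fintype ι] {W : Matrix ι ι ℝ}
    (hW : ∀ z : ι → ℝ, (∀ i, ∑ j, W i j * z j = z i) → ∃ c, ∀ i, z i = c)
    {x : ι → EuclideanSpace ℝ κ} (hx : ∀ i, ∑ j, W i j • x j = x i) :
    ∃ c, ∀ i, x i = c := by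
  have hcoord (k : κ) : ∃ c, ∀ i, x i k = c :=
    hW (fun i => x i k) fun i => by simpa using congrArg (fun v => v k) (hx i)
  choose c hc using hcoord
  exact ⟨WithLp.toLp 2 c, fun i => by ext k; exact hc k i⟩

/-- Any fixed point of the DIGing communication step satisfying the
gradient-tracking invariant is a consensus configuration at the exact global
optimum: all `yᵢ` vanish, all `xᵢ` agree on a common point `x̄`, and `x̄` is
the unique minimizer of `f = (1/N) ∑ᵢ fᵢ`. -/
theorem stmt_8 {d N : ℕ} (hN : 0 < N) {μ : ℝ} (hμ : 0 < μ) {α : ℝ} (hα : 0 < α)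
    (f : Fin N → EuclideanSpace ℝ (Fin d) → ℝ)
    (hdiff : ∀ i, Differentiable ℝ (f i))
    (hconv : ∀ i u v,
      ⟪gradient (f i) u - gradient (f i) v, u - v⟫ ≥ μ * ‖u - v‖ ^ 2)
    (W : Matrix (Fin N) (Fin N) ℝ) (hsym : W.IsSymm)
    (hrow : ∀ i, ∑ j, W i j = 1) (hcol : ∀ j, ∑ i, W i j = 1)
    (heig : ∀ z : Fin N → ℝ, (∀ i, ∑ j, W i j * z j = z i) → ∃ c, ∀ i, z i = c)
    (x y : Fin N → EuclideanSpace ℝ (Fin d))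
    (hfx : ∀ i, x i = (∑ j, W i j • x j) - α • y i)
    (hfy : ∀ i, y i = ∑ j, W i j • y j)
    (hinv : ∑ i, y i = ∑ i, gradient (f i) (x i)) :
    (∀ i, y i = 0) ∧
    ∃ xbar : EuclideanSpace ℝ (Fin d), (∀ i, x i = xbar) ∧
      (∀ z, (1 / (N : ℝ)) * ∑ i, f i xbar ≤ (1 / (N : ℝ)) * ∑ i, f i z) ∧
      (∀ w, (∀ z, (1 / (N : ℝ)) * ∑ i, f i w ≤ (1 / (N : ℝ)) * ∑ i, f i z) →
        w = xbar) := by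
  have hsum : ∑ i, y i = 0 := by
    have hmix : ∑ i, ∑ j, W i j • x j = ∑ j, x j := by
      rw [Finset.sum_comm]
      simp only [← Finset.sum_smul, hcol, one_smul]
    have h : ∑ i, x i = ∑ i, ((∑ j, W i j • x j) - α • y i) :=
      Finset.sum_congr rfl fun i _ => hfx i
    rw [Finset.sum_sub_distrib, hmix, ← Finset.smul_sum, eq_comm, sub_eq_self] at h
    exact (smul_eq_zero.mp h).resolve_left hα.ne'
  obtain ⟨c, hc⟩ := exists_eq_const_of_sum_smul_eq heig fun i => (hfy i).symm
  have hy (i) : y i = 0 := by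
    simp only [hc, Finset.sum_const, Finset.card_univ, Fintype.card_fin,
      ← Nat.cast_smul_eq_nsmul ℝ] at hsum
    rw [hc i]
    exact (smul_eq_zero.mp hsum).resolve_left (Nat.cast_ne_zero.mpr hN.ne')
  obtain ⟨xbar, hx⟩ := exists_eq_const_of_sum_smul_eq heig fun i => by
    simpa [hy] using (hfx i).symm
  have hgrad : ∑ i, gradient (f i) xbar = 0 := by simpa [hsum, hx] using hinv.symm
  have : Nonempty (Fin N) := ⟨⟨0, hN⟩⟩
  have hN' : (0 : ℝ) < 1 / N := by positivity
  have hlt {z} (hz : z ≠ xbar) : ∑ i, f i xbar < ∑ i, f i z := by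
    have h : ∑ i, (f i xbar + ⟪gradient (f i) xbar, z - xbar⟫) < ∑ i, f i z := by
      refine Finset.sum_lt_sum_of_nonempty Finset.univ_nonempty fun i _ =>
        add_inner_gradient_lt_of_strictMono_gradient (hdiff i) (fun u v huv => ?_) hz
      have huv' : 0 < ‖u - v‖ := norm_pos_iff.mpr (sub_ne_zero.mpr huv)
      exact lt_of_lt_of_le (by positivity) (hconv i u v)
    rwa [Finset.sum_add_distrib, ← sum_inner, hgrad, inner_zero_left, add_zero] at h
  refine ⟨hy, xbar, hx, fun z => ?_, fun w hw => ?_⟩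
  · rcases eq_or_ne z xbar with rfl | hz
    · exact le_rfl
    · exact mul_le_mul_of_nonneg_left (hlt hz).le hN'.le
  · by_contra hne
    exact (mul_lt_mul_of_pos_left (hlt hne) hN').not_ge (hw xbar)
end
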